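/- Lemma 1 (No value of information from the uninstructive price): Let P be a finite nonempty set of real prices. For k = 1,2 let a_k, b_k, c_k, d_k be real numbers, and define the carrier acceptance probability f_k^c(p) = σ(a_k + b_k·p), the shipper acceptance probability f_k^s(p) = σ(c_k + d_k·p), and f_k(p) = f_k^c(p)·f_k^s(p). Let q = (q_1, q_2) be a probability vector, and for p ∈ P define the knowledge gradient value ν(p) = Σ_{y ∈ {−1,1}²} max_{p' ∈ P} [ p'·Σ_{k=1}^2 q_k·f_k(p')·σ(y^c·(a_k + b_k·p))·σ(y^s·(c_k + d_k·p)) ] − max_{p' ∈ P} p'·Σ_{k=1}^2 q_k·f_k(p'). If p̂ ∈ P satisfies a_1 + b_1·p̂ = a_2 + b_2·p̂ and c_1 + d_1·p̂ = c_2 + d_2·p̂ (i.e., p̂ is an uninstructive price), then ν(p̂) = 0. -/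

import Mathlib

/-- The logistic function `σ(h) = 1/(1 + exp(-h))`. -/
noncomputable def sig (h : ℝ) : ℝ := 1 / (1 + Real.exp (-h))

/-- Encoding of an element of `{-1, 1}` by a Boolean: `true ↦ 1`, `false ↦ -1`. -/
def pm (b : Bool) : ℝ := if b then 1 else -1

/-- The likelihood `σ̃(y) = σ(y^c · u) · σ(y^s · v)` of the pair outcome
`y = (y^c, y^s) ∈ {-1,1}²` under the model with parameters `(u, v)`. -/
noncomputable def lik (u v : ℝ) (y : Bool × Bool) : ℝ :=
  sig (pm y.1 * u) * sig (pm y.2 * v)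

lemma sig_nonneg (h : ℝ) : 0 ≤ sig h := by
  unfold sig
  positivity

lemma sig_add_sig_neg (h : ℝ) : sig h + sig (-h) = 1 := by
  have := Real.exp_pos h
  unfold sig
  rw [neg_neg, Real.exp_neg]
  field_simp
  ring

lemma lik_nonneg (u v : ℝ) (y : Bool × Bool) : 0 ≤ lik u v y :=
  mul_nonneg (sig_nonneg _) (sig_nonneg _)

lemma sum_lik (u v : ℝ) : ∑ y, lik u v y = 1 := by
  simp only [lik, pm, Fintype.sum_prod_type, Fintype.sum_bool, if_true, Bool.false_eq_true,
    if_false, one_mul, neg_one_mul]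
  linear_combination (sig v + sig (-v)) * sig_add_sig_neg u + sig_add_sig_neg v

/-- Lemma 1 (No value of information from the uninstructive price): if `p̂ ∈ P` is an
uninstructive price for the two candidate models, i.e. the two carrier utilities agree at `p̂`
and the two shipper utilities agree at `p̂`, then the knowledge gradient value of bidding `p̂`
is zero. -/
theorem kg_value_of_uninstructive_price_eq_zero
    (P : Finset ℝ) (hP : P.Nonempty)
    (a b c d : Fin 2 → ℝ) (q : Fin 2 → ℝ)
    (hq : ∀ k, 0 ≤ q k) (hsum : ∑ k, q k = 1)
    (phat : ℝ) (hmem : phat ∈ P)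
    (hc : a 0 + b 0 * phat = a 1 + b 1 * phat)
    (hs : c 0 + d 0 * phat = c 1 + d 1 * phat) :
    (∑ y : Bool × Bool,
        P.sup' hP (fun p' => p' * ∑ k, q k *
          (sig (a k + b k * p') * sig (c k + d k * p')) *
          (sig (pm y.1 * (a k + b k * phat)) * sig (pm y.2 * (c k + d k * phat)))))
      - P.sup' hP (fun p' => p' * ∑ k, q k *
          (sig (a k + b k * p') * sig (c k + d k * p'))) = 0 := by
  have hfactor (y : Bool × Bool) :
      P.sup' hP (fun p' => p' * ∑ k, q k *
          (sig (a k + b k * p') * sig (c k + d k * p')) *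
          (sig (pm y.1 * (a k + b k * phat)) * sig (pm y.2 * (c k + d k * phat)))) =
        lik (a 0 + b 0 * phat) (c 0 + d 0 * phat) y *
          P.sup' hP (fun p' => p' * ∑ k, q k *
            (sig (a k + b k * p') * sig (c k + d k * p'))) := by
    rw [Finset.mul₀_sup' (lik_nonneg _ _ y)]
    refine Finset.sup'_congr hP rfl fun p' _ => ?_
    simp only [Fin.sum_univ_two, ← hc, ← hs, lik]
    ring
  rw [Finset.sum_congr rfl fun y _ => hfactor y, ← Finset.sum_mul, sum_lik, one_mul, sub_self]
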